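/- Fix K ≥ 1, y ∈ ℝ^K, ε > 0 and M ≥ 0. Let h : ℝ^K → ℝ^K be twice continuously differentiable with the operator norm of the Hessian of every component h_i bounded by M everywhere, and let ñ be a random vector in ℝ^K whose coordinates are independent with common distribution N(0, 1). Then | E_ñ[ ñᵀ (h(y + ε ñ) − h(y)) / ε ] − Σ_{i=1}^K (∂h_i/∂y_i)(y) | ≤ (ε M √K / 2) · E[‖ñ‖³]. -/

import Mathlib

open MeasureTheory ProbabilityTheory

/-- The law of a random vector in `ℝ^K` with i.i.d. standard normal coordinates. -/
noncomputable def stdGaussPi (K : ℕ) : Measure (Fin K → ℝ) :=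
  Measure.pi fun _ => gaussianReal 0 1

/-- Second-order Taylor estimate with the quadratic form of the second derivative bounded in the
direction of the increment. -/
lemma abs_taylor_one_remainder_le {E : Type*} [NormedAddCommGroup E] [NormedSpace ℝ E]
    {f : E → ℝ} (hf : ContDiff ℝ 2 f) (x v : E) {C : ℝ}
    (hC : ∀ z, |iteratedFDeriv ℝ 2 f z (fun _ => v)| ≤ C) :
    |f (x + v) - f x - fderiv ℝ f x v| ≤ C / 2 := by
  have hline (t : ℝ) : HasDerivAt (fun s : ℝ => x + s • v) v t := by
    simpa using ((hasDerivAt_id t).smul_const v).const_add x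
  have hf' : ContDiff ℝ 1 (fderiv ℝ f) := hf.fderiv_right (by norm_num)
  have hfirst (t : ℝ) : HasDerivAt (fun s : ℝ => f (x + s • v)) (fderiv ℝ f (x + t • v) v) t :=
    ((hf.differentiable (by norm_num)) (x + t • v)).hasFDerivAt.comp_hasDerivAt t (hline t)
  have hsecond (t : ℝ) : HasDerivAt (fun s : ℝ => fderiv ℝ f (x + s • v) v)
      (iteratedFDeriv ℝ 2 f (x + t • v) (fun _ => v)) t := by
    rw [iteratedFDeriv_two_apply]
    have := ((hf'.differentiable (by norm_num)) (x + t • v)).hasFDerivAt.comp_hasDerivAt t (hline t)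
    simpa using this.clm_apply (hasDerivAt_const t v)
  have hslope (t : ℝ) (ht : t ∈ Set.Icc (0 : ℝ) 1) :
      ‖fderiv ℝ f (x + t • v) v - fderiv ℝ f x v‖ ≤ C * t := by
    have := norm_image_sub_le_of_norm_deriv_right_le_segment (a := 0) (b := 1)
      (f := fun s : ℝ => fderiv ℝ f (x + s • v) v)
      (fun s _ => (hsecond s).continuousAt.continuousWithinAt)
      (fun s _ => (hsecond s).hasDerivWithinAt) (fun s _ => hC _) t ht
    simpa using this
  have := image_norm_le_of_norm_deriv_right_le_deriv_boundary (a := 0) (b := 1)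
    (f := fun s : ℝ => f (x + s • v) - f x - s * fderiv ℝ f x v)
    (f' := fun s => fderiv ℝ f (x + s • v) v - fderiv ℝ f x v)
    (B := fun s => C / 2 * s ^ 2) (B' := fun s => C * s)
    (fun s _ => (((hfirst s).sub_const _).sub
      ((hasDerivAt_id s).mul_const _)).continuousAt.continuousWithinAt)
    (fun s _ => by
      have := ((hfirst s).sub_const (f x)).sub ((hasDerivAt_id s).mul_const (fderiv ℝ f x v))
      exact (this.congr_deriv (by simp)).hasDerivWithinAt)
    (by simp)
    (fun s => ((hasDerivAt_pow 2 s).const_mul (C / 2)).congr_deriv (by simp; ring))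
    (fun s hs => hslope s ⟨hs.1, hs.2.le⟩) (Set.right_mem_Icc.2 zero_le_one)
  simpa using this

instance (K : ℕ) : IsProbabilityMeasure (stdGaussPi K) := by
  unfold stdGaussPi; infer_instance

lemma memLp_two_eval_stdGaussPi {K : ℕ} (i : Fin K) :
    MemLp (fun n : Fin K → ℝ => n i) 2 (stdGaussPi K) :=
  (memLp_id_gaussianReal 2).comp_measurePreserving
    (measurePreserving_eval (fun _ : Fin K => gaussianReal 0 1) i)

lemma integrable_eval_mul_eval_stdGaussPi {K : ℕ} (i j : Fin K) :
    Integrable (fun n : Fin K → ℝ => n i * n j) (stdGaussPi K) :=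
  (memLp_two_eval_stdGaussPi i).integrable_mul (memLp_two_eval_stdGaussPi j)

lemma integral_eval_stdGaussPi {K : ℕ} (i : Fin K) : ∫ n, n i ∂stdGaussPi K = 0 := by
  have hmp := measurePreserving_eval (fun _ : Fin K => gaussianReal 0 1) i
  rw [← integral_id_gaussianReal (μ := 0) (v := 1), ← hmp.map_eq,
    integral_map hmp.measurable.aemeasurable (by fun_prop)]
  rfl

/-- The coordinates of a standard Gaussian vector are orthonormal. -/
lemma integral_eval_mul_eval_stdGaussPi {K : ℕ} (i j : Fin K) :
    ∫ n, n i * n j ∂stdGaussPi K = if i = j then 1 else 0 := by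
  have hcov := covariance_eq_sub (memLp_two_eval_stdGaussPi i) (memLp_two_eval_stdGaussPi j)
  rw [integral_eval_stdGaussPi, zero_mul, sub_zero] at hcov
  refine hcov.symm.trans ?_
  split_ifs with hij
  · subst hij
    have hmp := measurePreserving_eval (fun _ : Fin K => gaussianReal 0 1) i
    rw [covariance_self (measurable_pi_apply i).aemeasurable]
    have hvar := variance_id_gaussianReal (μ := 0) (v := 1)
    rw [← hmp.map_eq, variance_map (by fun_prop) hmp.measurable.aemeasurable] at hvar
    exact hvar.trans NNReal.coe_one
  · have hind : iIndepFun (fun (i : Fin K) (n : Fin K → ℝ) => n i) (stdGaussPi K) :=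
      iIndepFun_pi (X := fun _ => id) (fun _ => aemeasurable_id)
    exact (hind.indepFun hij).covariance_eq_zero
      (memLp_two_eval_stdGaussPi i) (memLp_two_eval_stdGaussPi j)

lemma sum_abs_le_sqrt_card_mul_sqrt_sum_sq {ι : Type*} [Fintype ι] (v : ι → ℝ) :
    ∑ i, |v i| ≤ √(Fintype.card ι) * √(∑ i, v i ^ 2) := by
  rw [← Real.sqrt_mul (Nat.cast_nonneg _)]
  apply Real.le_sqrt_of_sq_le
  simpa using sq_sum_le_card_mul_sum_sq (s := Finset.univ) (f := fun i => |v i|)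

lemma integrable_sqrt_sum_sq_pow_stdGaussPi (K p : ℕ) :
    Integrable (fun n : Fin K → ℝ => √(∑ i, n i ^ 2) ^ p) (stdGaussPi K) := by
  have hint := (IsGaussian.memLp_id (stdGaussian (EuclideanSpace ℝ (Fin K))) p
    (by simp)).integrable_norm_pow'
  rw [← map_pi_eq_stdGaussian] at hint
  simpa [stdGaussPi, Function.comp_def, EuclideanSpace.norm_eq] using
    hint.comp_measurable (WithLp.measurable_toLp 2 (Fin K → ℝ))

lemma sum_mul_clm_apply_eq_double_sum {K : ℕ} (L : (Fin K → ℝ) →L[ℝ] (Fin K → ℝ))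
    (n : Fin K → ℝ) :
    ∑ i, n i * L n i = ∑ i, ∑ j, L (Pi.single j 1) i * (n i * n j) := by
  refine Finset.sum_congr rfl fun i _ => ?_
  have : L n = ∑ j, n j • L (Pi.single j 1) := by
    conv_lhs => rw [pi_eq_sum_univ' n]
    simp [map_sum]
  rw [this, Finset.sum_apply, Finset.mul_sum]
  refine Finset.sum_congr rfl fun j _ => ?_
  simp only [Pi.smul_apply, smul_eq_mul]
  ring

lemma integrable_sum_mul_clm_apply_stdGaussPi {K : ℕ} (L : (Fin K → ℝ) →L[ℝ] (Fin K → ℝ)) :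
    Integrable (fun n => ∑ i, n i * L n i) (stdGaussPi K) := by
  simp_rw [sum_mul_clm_apply_eq_double_sum]
  exact integrable_finsetSum _ fun i _ => integrable_finsetSum _ fun j _ =>
    (integrable_eval_mul_eval_stdGaussPi i j).const_mul _

/-- Hutchinson's trace identity for a standard Gaussian probe. -/
lemma integral_sum_mul_clm_apply_stdGaussPi {K : ℕ} (L : (Fin K → ℝ) →L[ℝ] (Fin K → ℝ)) :
    ∫ n, ∑ i, n i * L n i ∂stdGaussPi K = ∑ i, L (Pi.single i 1) i := by
  have hint (i j : Fin K) := (integrable_eval_mul_eval_stdGaussPi i j).const_mul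
    (L (Pi.single j 1) i)
  simp_rw [sum_mul_clm_apply_eq_double_sum]
  rw [integral_finsetSum _ fun i _ => integrable_finsetSum _ fun j _ => hint i j]
  refine Finset.sum_congr rfl fun i _ => ?_
  rw [integral_finsetSum _ fun j _ => hint i j]
  simp [integral_const_mul, integral_eval_mul_eval_stdGaussPi]

/-- The Monte-Carlo divergence bound when the Hessian quadratic forms are controlled by the
Euclidean norm. -/
lemma mc_divergence_error_bound_of_quadratic_form_le {K : ℕ} (y : Fin K → ℝ)
    {ε : ℝ} (hε : 0 < ε) {M : ℝ} (hM : 0 ≤ M)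
    {h : (Fin K → ℝ) → (Fin K → ℝ)} (hh : ContDiff ℝ 2 h)
    (hquad : ∀ (i : Fin K) (z v : Fin K → ℝ),
      |iteratedFDeriv ℝ 2 (fun w => h w i) z (fun _ => v)| ≤ M * ∑ j, v j ^ 2) :
    |(∫ n, (∑ i, n i * (h (y + ε • n) i - h y i)) / ε ∂(stdGaussPi K))
        - ∑ i, fderiv ℝ h y (Pi.single i 1) i|
      ≤ ε * M * Real.sqrt K / 2 * ∫ n, (Real.sqrt (∑ i, (n i) ^ 2)) ^ 3 ∂(stdGaussPi K) := by
  set L := fderiv ℝ h y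
  set R : (Fin K → ℝ) → ℝ := fun n =>
    (∑ i, n i * (h (y + ε • n) i - h y i)) / ε - ∑ i, n i * L n i with hR
  have hcomp (i : Fin K) (v : Fin K → ℝ) : fderiv ℝ (fun w => h w i) y v = L v i := by
    have := hasFDerivAt_pi'.1 ((hh.differentiable (by norm_num)) y).hasFDerivAt i
    rw [this.fderiv]
    rfl
  have hterm (n : Fin K → ℝ) (i : Fin K) :
      |h (y + ε • n) i - h y i - ε * L n i| ≤ M * (ε ^ 2 * ∑ j, n j ^ 2) / 2 := by
    have := abs_taylor_one_remainder_le (contDiff_pi.1 hh i) y (ε • n) (hquad i · (ε • n))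
    simpa [hcomp, mul_pow, ← Finset.mul_sum] using this
  have hRbound (n : Fin K → ℝ) : ‖R n‖ ≤ ε * M * √K / 2 * √(∑ i, n i ^ 2) ^ 3 := by
    have hRn : R n = (∑ i, n i * (h (y + ε • n) i - h y i - ε * L n i)) / ε := by
      simp only [hR, mul_sub, Finset.sum_sub_distrib]
      rw [sub_div _ (∑ i, n i * (ε * L n i)), eq_comm]
      congr 1
      rw [div_eq_iff hε.ne', Finset.sum_mul]
      exact Finset.sum_congr rfl fun i _ => by ring
    rw [hRn, Real.norm_eq_abs, abs_div, abs_of_pos hε, div_le_iff₀ hε]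
    calc |∑ i, n i * (h (y + ε • n) i - h y i - ε * L n i)|
        ≤ ∑ i, |n i| * (M * (ε ^ 2 * ∑ j, n j ^ 2) / 2) :=
          (Finset.abs_sum_le_sum_abs _ _).trans <| Finset.sum_le_sum fun i _ => by
            rw [abs_mul]
            exact mul_le_mul_of_nonneg_left (hterm n i) (abs_nonneg _)
      _ = (∑ i, |n i|) * (M * (ε ^ 2 * √(∑ j, n j ^ 2) ^ 2) / 2) := by
          rw [Finset.sum_mul, Real.sq_sqrt (by positivity)]
      _ ≤ (√K * √(∑ i, n i ^ 2)) * (M * (ε ^ 2 * √(∑ j, n j ^ 2) ^ 2) / 2) := by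
          gcongr
          simpa using sum_abs_le_sqrt_card_mul_sqrt_sum_sq n
      _ = ε * M * √K / 2 * √(∑ i, n i ^ 2) ^ 3 * ε := by ring
  have hcube := (integrable_sqrt_sum_sq_pow_stdGaussPi K 3).const_mul (ε * M * √K / 2)
  have hcont : Continuous R := by
    have := hh.continuous
    fun_prop
  have hRint : Integrable R (stdGaussPi K) :=
    hcube.mono' hcont.aestronglyMeasurable (ae_of_all _ hRbound)
  have hsplit : ∫ n, (∑ i, n i * (h (y + ε • n) i - h y i)) / ε ∂(stdGaussPi K)
      = ∫ n, R n ∂(stdGaussPi K) + ∑ i, L (Pi.single i 1) i := by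
    rw [← integral_sum_mul_clm_apply_stdGaussPi,
      ← integral_add hRint (integrable_sum_mul_clm_apply_stdGaussPi L)]
    simp [hR]
  rw [hsplit, add_sub_cancel_right, ← integral_const_mul]
  exact norm_integral_le_of_norm_le hcube (ae_of_all _ hRbound)

/-- **Quantitative Monte-Carlo SURE divergence bound.** If `h : ℝ^K → ℝ^K` is `C²`
with the (operator) norm of the Hessian of every component bounded by `M` everywhere,
`ε > 0`, and `ñ` has i.i.d. `N(0,1)` coordinates, then
`|E[ñᵀ(h(y + εñ) − h(y))/ε] − ∑ᵢ ∂hᵢ/∂yᵢ(y)| ≤ (ε M √K / 2) · E[‖ñ‖³]`,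
where `‖·‖` is the Euclidean norm. -/
theorem mc_sure_divergence_error_bound (K : ℕ) (hK : 1 ≤ K) (y : Fin K → ℝ)
    (ε : ℝ) (hε : 0 < ε) (M : ℝ) (hM : 0 ≤ M)
    (h : (Fin K → ℝ) → (Fin K → ℝ)) (hh : ContDiff ℝ 2 h)
    (hHess : ∀ (i : Fin K) (z : Fin K → ℝ),
      ‖iteratedFDeriv ℝ 2 (fun w => h w i) z‖ ≤ M) :
    |(∫ n, (∑ i, n i * (h (y + ε • n) i - h y i)) / ε ∂(stdGaussPi K))
        - ∑ i, fderiv ℝ h y (Pi.single i 1) i|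
      ≤ ε * M * Real.sqrt K / 2 * ∫ n, (Real.sqrt (∑ i, (n i) ^ 2)) ^ 3 ∂(stdGaussPi K) := by
  refine mc_divergence_error_bound_of_quadratic_form_le y hε hM hh fun i z v => ?_
  have hsup : ‖v‖ ^ 2 ≤ ∑ j, v j ^ 2 := by
    have : ‖v‖ ≤ √(∑ j, v j ^ 2) := (pi_norm_le_iff_of_nonneg (Real.sqrt_nonneg _)).2 fun j =>
      Real.abs_le_sqrt (Finset.single_le_sum (fun k _ => sq_nonneg (v k)) (Finset.mem_univ j))
    simpa [Real.sq_sqrt (Finset.sum_nonneg fun j _ => sq_nonneg (v j))] using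
      pow_le_pow_left₀ (norm_nonneg v) this 2
  have := (iteratedFDeriv ℝ 2 (fun w => h w i) z).le_of_opNorm_le (hHess i z) (fun _ => v)
  calc |iteratedFDeriv ℝ 2 (fun w => h w i) z (fun _ => v)| ≤ M * ‖v‖ ^ 2 := by simpa using this
    _ ≤ M * ∑ j, v j ^ 2 := by gcongr
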